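/- With κ := 2·log 2/(log 75 − log 2), the κ-dimensional lower and upper quantization coefficients of the condensation measure P are finite and positive; more precisely, (25/4)^{1/κ}·(769208/5884749) ≤ liminf_{n→∞} n^{2/κ}·V_n(P) ≤ limsup_{n→∞} n^{2/κ}·V_n(P) ≤ 100^{1/κ}·(769208/5884749). -/

import Mathlib

open MeasureTheory Metric Set Filter

/-- The distortion error of a set `α` of quantizer points for `μ`, of order 2:
`∫ min_{a ∈ α} (x - a)^2 dμ(x)`. -/
noncomputable def distortion (μ : MeasureTheory.Measure ℝ) (α : Set ℝ) : ℝ :=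
  ∫ x, (Metric.infDist x α) ^ 2 ∂μ

/-- The `n`th quantization error of order 2 for `μ`. -/
noncomputable def quantErr (μ : MeasureTheory.Measure ℝ) (n : ℕ) : ℝ :=
  sInf {e : ℝ | ∃ α : Set ℝ, α.Finite ∧ α.Nonempty ∧ α.ncard ≤ n ∧ e = distortion μ α}

/-- `α` is an optimal set of `n`-means for `μ`. -/
def IsOptimalSet (μ : MeasureTheory.Measure ℝ) (n : ℕ) (α : Set ℝ) : Prop :=
  α.Finite ∧ α.Nonempty ∧ α.ncard ≤ n ∧ distortion μ α = quantErr μ n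

/-- The similarity `S₁(x) = x/5`. -/
noncomputable def S1 : ℝ → ℝ := fun x => x / 5

/-- The similarity `S₂(x) = x/5 + 4/5`. -/
noncomputable def S2 : ℝ → ℝ := fun x => x / 5 + 4 / 5

/-- `P` is the condensation measure associated with `(S₁, S₂; 1/3, 1/3, 1/3; ν)`:
`P = (1/3) P∘S₁⁻¹ + (1/3) P∘S₂⁻¹ + (1/3) ν`. -/
def IsCondensation (P ν : MeasureTheory.Measure ℝ) : Prop :=
  MeasureTheory.IsProbabilityMeasure P ∧
    P = (1 / 3 : ENNReal) • P.map S1 + (1 / 3 : ENNReal) • P.map S2 + (1 / 3 : ENNReal) • ν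

/-- The point `a_{j+1} = 3/5 - 1/(5 · 2^j)` (so `aseq 0 = a₁ = 2/5`). -/
noncomputable def aseq (j : ℕ) : ℝ := 3 / 5 - 1 / (5 * 2 ^ j)

/-- The infinite discrete distribution `ν = ∑_{j ≥ 1} 2^{-j} δ_{a_j}`. -/
noncomputable def nuDisc : MeasureTheory.Measure ℝ :=
  MeasureTheory.Measure.sum
    (fun j : ℕ => ((1 / 2 : ENNReal) ^ (j + 1)) • MeasureTheory.Measure.dirac (aseq j))

lemma aseq_succ (j : ℕ) : aseq (j + 1) = aseq j / 2 + 3 / 10 := by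
  unfold aseq; field_simp; ring

lemma aseq_mem_Icc (j : ℕ) : aseq j ∈ Icc (0 : ℝ) 1 := by
  induction j with
  | zero => norm_num [aseq]
  | succ j ih => rw [aseq_succ]; constructor <;> linarith [ih.1, ih.2]

lemma nuDisc_eq : nuDisc = (1 / 2 : ENNReal) • Measure.dirac (2 / 5) +
    (1 / 2 : ENNReal) • nuDisc.map (fun x => x / 2 + 3 / 10) := by
  have hT : Measurable (fun x : ℝ => x / 2 + 3 / 10) := by fun_prop
  ext s hs
  rw [Measure.add_apply, Measure.smul_apply, Measure.smul_apply, Measure.map_apply hT hs]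
  simp only [nuDisc, Measure.sum_apply _ hs, Measure.sum_apply _ (hT hs), Measure.smul_apply,
    Measure.dirac_apply' _ hs, Measure.dirac_apply' _ (hT hs), smul_eq_mul]
  rw [tsum_eq_zero_add' ENNReal.summable, ← ENNReal.tsum_mul_left]
  congr 1
  · norm_num [aseq]
  · refine tsum_congr fun j => ?_
    rw [aseq_succ, pow_succ' _ (j + 1), mul_assoc]
    rfl

instance isProbabilityMeasure_nuDisc : IsProbabilityMeasure nuDisc := by
  constructor
  simp only [nuDisc, Measure.sum_apply _ MeasurableSet.univ, Measure.smul_apply, measure_univ,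
    smul_eq_mul, mul_one, pow_succ']
  rw [ENNReal.tsum_mul_left, ENNReal.tsum_geometric, one_div, ENNReal.one_sub_inv_two, inv_inv]
  exact ENNReal.inv_mul_cancel (by norm_num) (by norm_num)

lemma ae_mem_Icc_nuDisc : ∀ᵐ x ∂nuDisc, x ∈ Icc (0 : ℝ) 1 := by
  rw [nuDisc, Measure.ae_sum_iff]
  intro j
  refine Measure.ae_smul_measure ?_ _
  exact (ae_dirac_iff measurableSet_Icc).2 (aseq_mem_Icc j)

lemma Continuous.integrable_of_ae_mem_Icc {μ : Measure ℝ} [IsFiniteMeasure μ]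
    (h : ∀ᵐ x ∂μ, x ∈ Icc (0 : ℝ) 1) {f : ℝ → ℝ} (hf : Continuous f) : Integrable f μ := by
  rw [← Measure.restrict_eq_self_of_ae_mem h]
  exact hf.continuousOn.integrableOn_compact isCompact_Icc

lemma IsCondensation.ae_mem_Icc {P : Measure ℝ} (hP : IsCondensation P nuDisc) :
    ∀ᵐ x ∂P, x ∈ Icc (0 : ℝ) 1 := by
  have := hP.1
  have h1 : Measurable S1 := by unfold S1; fun_prop
  have h2 : Measurable S2 := by unfold S2; fun_prop
  have hJ : MeasurableSet (Icc (0 : ℝ) 1)ᶜ := measurableSet_Icc.compl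
  have hν : nuDisc (Icc (0 : ℝ) 1)ᶜ = 0 := ae_mem_Icc_nuDisc
  have e := congrArg (fun μ : Measure ℝ => μ (Icc (0 : ℝ) 1)ᶜ) hP.2
  simp only [Measure.add_apply, Measure.smul_apply, Measure.map_apply h1 hJ,
    Measure.map_apply h2 hJ, hν, smul_eq_mul, mul_zero, add_zero] at e
  have l1 : P (S1 ⁻¹' (Icc (0 : ℝ) 1)ᶜ) ≤ P (Icc (0 : ℝ) 1)ᶜ := by
    refine measure_mono fun x hx hx' => hx ?_
    simp only [S1, mem_Icc] at *
    constructor <;> linarith [hx'.1, hx'.2]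
  have l2 : P (S2 ⁻¹' (Icc (0 : ℝ) 1)ᶜ) ≤ P (Icc (0 : ℝ) 1)ᶜ := by
    refine measure_mono fun x hx hx' => hx ?_
    simp only [S2, mem_Icc] at *
    constructor <;> linarith [hx'.1, hx'.2]
  have r := congrArg ENNReal.toReal e
  rw [ENNReal.toReal_add (by finiteness) (by finiteness), ENNReal.toReal_mul,
    ENNReal.toReal_mul] at r
  have r1 := ENNReal.toReal_mono (by finiteness) l1
  have r2 := ENNReal.toReal_mono (by finiteness) l2
  norm_num at r
  rw [preimage_compl] at r1 r2
  have hz : (P (Icc (0 : ℝ) 1)ᶜ).toReal = 0 :=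
    le_antisymm (by linarith) ENNReal.toReal_nonneg
  exact ((ENNReal.toReal_eq_zero_iff _).1 hz).resolve_right (by finiteness)

lemma integral_nuDisc {f : ℝ → ℝ} (hf : Continuous f) :
    ∫ x, f x ∂nuDisc = 1 / 2 * f (2 / 5) + 1 / 2 * ∫ x, f (x / 2 + 3 / 10) ∂nuDisc := by
  have hT : Continuous (fun x : ℝ => x / 2 + 3 / 10) := by fun_prop
  have hi : Integrable f (nuDisc.map (fun x => x / 2 + 3 / 10)) :=
    (integrable_map_measure hf.aestronglyMeasurable hT.aemeasurable).2
      ((hf.comp hT).integrable_of_ae_mem_Icc ae_mem_Icc_nuDisc)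
  conv_lhs => rw [nuDisc_eq]
  rw [integral_add_measure ((integrable_dirac (by simp)).smul_measure (by simp))
    (hi.smul_measure (by simp)), integral_smul_measure, integral_smul_measure,
    integral_dirac, integral_map hT.aemeasurable hf.aestronglyMeasurable]
  simp

lemma IsCondensation.integral_eq {P : Measure ℝ} (hP : IsCondensation P nuDisc) {f : ℝ → ℝ}
    (hf : Continuous f) :
    ∫ x, f x ∂P = 1 / 3 * ∫ x, f (x / 5) ∂P + 1 / 3 * ∫ x, f (x / 5 + 4 / 5) ∂P +
      1 / 3 * ∫ x, f x ∂nuDisc := by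
  have := hP.1
  have h1 : Continuous S1 := by unfold S1; fun_prop
  have h2 : Continuous S2 := by unfold S2; fun_prop
  have i1 : Integrable f (P.map S1) :=
    (integrable_map_measure hf.aestronglyMeasurable h1.aemeasurable).2
      ((hf.comp h1).integrable_of_ae_mem_Icc hP.ae_mem_Icc)
  have i2 : Integrable f (P.map S2) :=
    (integrable_map_measure hf.aestronglyMeasurable h2.aemeasurable).2
      ((hf.comp h2).integrable_of_ae_mem_Icc hP.ae_mem_Icc)
  have i3 : Integrable f nuDisc := hf.integrable_of_ae_mem_Icc ae_mem_Icc_nuDisc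
  conv_lhs => rw [hP.2]
  rw [integral_add_measure ((i1.smul_measure (by simp)).add_measure (i2.smul_measure (by simp)))
    (i3.smul_measure (by simp)), integral_add_measure (i1.smul_measure (by simp))
    (i2.smul_measure (by simp)), integral_smul_measure, integral_smul_measure,
    integral_smul_measure, integral_map h1.aemeasurable hf.aestronglyMeasurable,
    integral_map h2.aemeasurable hf.aestronglyMeasurable]
  simp [S1, S2]

lemma continuous_infDist_sq (α : Set ℝ) : Continuous fun x => infDist x α ^ 2 :=
  (continuous_infDist_pt α).pow 2

lemma exists_infDist_sq_eq {α : Set ℝ} (hf : α.Finite) (hn : α.Nonempty) (x : ℝ) :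
    ∃ y ∈ α, infDist x α ^ 2 = (x - y) ^ 2 := by
  obtain ⟨y, hy, h⟩ := hf.isCompact.exists_infDist_eq_dist hn x
  exact ⟨y, hy, by rw [h, Real.dist_eq, sq_abs]⟩

lemma infDist_sq_le {α : Set ℝ} {y : ℝ} (hy : y ∈ α) (x : ℝ) : infDist x α ^ 2 ≤ (x - y) ^ 2 := by
  rw [← sq_abs (x - y), ← Real.dist_eq]
  exact pow_le_pow_left₀ infDist_nonneg (infDist_le_dist_of_mem hy) 2

lemma infDist_preimage_affine_le {α : Set ℝ} (hf : α.Finite) (hn : α.Nonempty) {r : ℝ}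
    (hr : r ≠ 0) (b x : ℝ) :
    r ^ 2 * infDist x ((fun y => r * y + b) ⁻¹' α) ^ 2 ≤ infDist (r * x + b) α ^ 2 := by
  obtain ⟨y, hy, h⟩ := exists_infDist_sq_eq hf hn (r * x + b)
  have hz : (y - b) / r ∈ (fun y => r * y + b) ⁻¹' α := by
    rwa [mem_preimage, mul_div_cancel₀ _ hr, sub_add_cancel]
  rw [h]
  calc _ ≤ r ^ 2 * (x - (y - b) / r) ^ 2 := mul_le_mul_of_nonneg_left (infDist_sq_le hz x) (sq_nonneg r)
    _ = _ := by field_simp; ring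

lemma infDist_affine_le {α β : Set ℝ} (hf : α.Finite) (hn : α.Nonempty) {r b : ℝ}
    (h : (fun y => r * y + b) '' α ⊆ β) (x : ℝ) :
    infDist (r * x + b) β ^ 2 ≤ r ^ 2 * infDist x α ^ 2 := by
  obtain ⟨y, hy, e⟩ := exists_infDist_sq_eq hf hn x
  rw [e]
  calc _ ≤ (r * x + b - (r * y + b)) ^ 2 := infDist_sq_le (h ⟨y, hy, rfl⟩) _
    _ = _ := by ring

lemma preimage_affine_finite {α : Set ℝ} (hf : α.Finite) {r : ℝ} (hr : r ≠ 0) (b : ℝ) :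
    ((fun y => r * y + b) ⁻¹' α).Finite :=
  hf.preimage fun x _ y _ h => by simpa [hr] using h

lemma preimage_affine_nonempty {α : Set ℝ} (hn : α.Nonempty) {r : ℝ} (hr : r ≠ 0) (b : ℝ) :
    ((fun y => r * y + b) ⁻¹' α).Nonempty := by
  obtain ⟨y, hy⟩ := hn
  exact ⟨(y - b) / r, by rwa [mem_preimage, mul_div_cancel₀ _ hr, sub_add_cancel]⟩

lemma ncard_preimage_affine_inter {α : Set ℝ} {r : ℝ} (hr : 0 < r) (b u v : ℝ) :
    ((fun y => r * y + b) ⁻¹' α ∩ Ioo u v).ncard = (α ∩ Ioo (r * u + b) (r * v + b)).ncard := by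
  have hinj : Function.Injective (fun y => r * y + b) := fun x y h => by simpa [hr.ne'] using h
  rw [← ncard_image_of_injective _ hinj]
  congr 1
  ext y
  simp only [mem_image, mem_inter_iff, mem_preimage, mem_Ioo]
  constructor
  · rintro ⟨x, ⟨hx, h1, h2⟩, rfl⟩
    exact ⟨hx, by gcongr, by gcongr⟩
  · rintro ⟨hy, h1, h2⟩
    have e : r * ((y - b) / r) + b = y := by rw [mul_div_cancel₀ _ hr.ne', sub_add_cancel]
    refine ⟨(y - b) / r, ⟨by rwa [e], ?_, ?_⟩, e⟩
    · rw [lt_div_iff₀ hr]; linarith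
    · rw [div_lt_iff₀ hr]; linarith

lemma le_integral_nuDisc {f : ℝ → ℝ} (hf : Continuous f) (h0 : ∀ x, 0 ≤ f x) :
    1 / 2 * f (2 / 5) + 1 / 4 * f (1 / 2) + 1 / 8 * f (11 / 20) ≤ ∫ x, f x ∂nuDisc := by
  have hT : Continuous (fun x : ℝ => x / 2 + 3 / 10) := by fun_prop
  have e1 := integral_nuDisc hf
  have e2 := integral_nuDisc (hf.comp hT)
  have e3 := integral_nuDisc ((hf.comp hT).comp hT)
  simp only [Function.comp] at e2 e3
  have : 0 ≤ ∫ x, f (((x / 2 + 3 / 10) / 2 + 3 / 10) / 2 + 3 / 10) ∂nuDisc :=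
    integral_nonneg fun x => h0 _
  norm_num at e1 e2 e3 ⊢
  linarith

/-- The contribution of the tail of `nuDisc` to the distortion. -/
lemma distortion_nuDisc_ge {α : Set ℝ} (hf : α.Finite) (hn : α.Nonempty) :
    1 / 2 * infDist (2 / 5) α ^ 2 +
      1 / 8 * distortion nuDisc ((fun y => 1 / 2 * y + 3 / 10) ⁻¹' α) ≤ distortion nuDisc α := by
  unfold distortion
  rw [integral_nuDisc (continuous_infDist_sq α)]
  have hT : Continuous (fun x : ℝ => x / 2 + 3 / 10) := by fun_prop
  have : (1 / 2 : ℝ) ^ 2 * ∫ x, infDist x ((fun y => 1 / 2 * y + 3 / 10) ⁻¹' α) ^ 2 ∂nuDisc ≤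
      ∫ x, infDist (x / 2 + 3 / 10) α ^ 2 ∂nuDisc := by
    rw [← integral_const_mul]
    refine integral_mono
      ((continuous_infDist_sq _).const_mul _ |>.integrable_of_ae_mem_Icc ae_mem_Icc_nuDisc)
      ((continuous_infDist_sq α).comp hT |>.integrable_of_ae_mem_Icc ae_mem_Icc_nuDisc) fun x => ?_
    have := infDist_preimage_affine_le hf hn (r := 1 / 2) (by norm_num) (3 / 10) x
    rwa [show 1 / 2 * x + 3 / 10 = x / 2 + 3 / 10 by ring] at this
  linarith

lemma distortion_nuDisc_lower (m : ℕ) : ∀ {α : Set ℝ}, α.Finite → α.Nonempty →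
    (α ∩ Ioo (3 / 10) (7 / 10)).ncard ≤ m → 2 / 125 * (1 / 8) ^ m ≤ distortion nuDisc α := by
  induction m with
  | zero =>
    intro α hf hn hm
    have he : α ∩ Ioo (3 / 10) (7 / 10) = ∅ :=
      (ncard_eq_zero (hf.inter_of_left _)).1 (Nat.le_zero.1 hm)
    have key : ∀ x : ℝ, 2 / 5 ≤ x → x ≤ 3 / 5 →
        min ((x - 3 / 10) ^ 2) ((7 / 10 - x) ^ 2) ≤ infDist x α ^ 2 := by
      intro x h1 h2
      obtain ⟨y, hy, e⟩ := exists_infDist_sq_eq hf hn x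
      have hy' : y ∉ Ioo (3 / 10 : ℝ) (7 / 10) := fun h => by
        have : y ∈ α ∩ Ioo (3 / 10) (7 / 10) := ⟨hy, h⟩
        simp [he] at this
      rw [mem_Ioo, not_and_or, not_lt, not_lt] at hy'
      rw [e, min_le_iff]
      rcases hy' with h | h
      · left; nlinarith
      · right; nlinarith
    have := le_integral_nuDisc (continuous_infDist_sq α) fun x => sq_nonneg _
    have k1 := key (2 / 5) (by norm_num) (by norm_num)
    have k2 := key (1 / 2) (by norm_num) (by norm_num)
    have k3 := key (11 / 20) (by norm_num) (by norm_num)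
    norm_num at k1 k2 k3
    unfold distortion
    norm_num
    linarith
  | succ m ih =>
    intro α hf hn hm
    have tail := distortion_nuDisc_ge hf hn
    have hf' := preimage_affine_finite hf (r := 1 / 2) (by norm_num) (3 / 10)
    have hn' := preimage_affine_nonempty hn (r := 1 / 2) (by norm_num) (3 / 10)
    have D0 : 0 ≤ distortion nuDisc ((fun y => 1 / 2 * y + 3 / 10) ⁻¹' α) :=
      integral_nonneg fun x => sq_nonneg _
    obtain ⟨y, hy, e⟩ := exists_infDist_sq_eq hf hn (2 / 5)
    by_cases hd : (2 / 5 - y) ^ 2 < 1 / 400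
    · have hyl : 3 / 10 < y := by nlinarith
      have hyr : y < 9 / 20 := by nlinarith
      have hc : ((fun y => 1 / 2 * y + 3 / 10) ⁻¹' α ∩ Ioo (3 / 10) (7 / 10)).ncard ≤ m := by
        rw [ncard_preimage_affine_inter (by norm_num)]
        refine Nat.lt_succ_iff.1 (lt_of_lt_of_le (ncard_lt_ncard ?_ (hf.inter_of_left _)) hm)
        refine ⟨fun z hz => ⟨hz.1, ?_, ?_⟩, fun h => ?_⟩
        · linarith [hz.2.1]
        · linarith [hz.2.2]
        · have := (h ⟨hy, hyl, by linarith⟩).2.1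
          linarith
      have := ih hf' hn' hc
      rw [pow_succ]
      nlinarith [sq_nonneg (infDist (2 / 5) α)]
    · rcases Nat.eq_zero_or_pos m with rfl | hmpos
      · have three := le_integral_nuDisc (continuous_infDist_sq α) fun x => sq_nonneg _
        obtain ⟨z, hz, ez⟩ := exists_infDist_sq_eq hf hn (1 / 2)
        obtain ⟨w, hw, ew⟩ := exists_infDist_sq_eq hf hn (11 / 20)
        rw [e, ez, ew] at three
        unfold distortion
        have out : ∀ x y : ℝ, 2 / 5 ≤ x → x ≤ 3 / 5 → y ∉ Ioo (3 / 10 : ℝ) (7 / 10) →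
            min ((x - 3 / 10) ^ 2) ((7 / 10 - x) ^ 2) ≤ (x - y) ^ 2 := by
          intro x y h1 h2 hy'
          rw [mem_Ioo, not_and_or, not_lt, not_lt] at hy'
          rw [min_le_iff]
          rcases hy' with h | h
          · left; nlinarith
          · right; nlinarith
        by_cases iy : y ∈ Ioo (3 / 10 : ℝ) (7 / 10)
        · by_cases iz : z ∈ Ioo (3 / 10 : ℝ) (7 / 10)
          · by_cases iw : w ∈ Ioo (3 / 10 : ℝ) (7 / 10)
            · have one := (ncard_le_one (hf.inter_of_left _)).1 hm
              have e1 := one y ⟨hy, iy⟩ z ⟨hz, iz⟩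
              have e2 := one y ⟨hy, iy⟩ w ⟨hw, iw⟩
              subst e1 e2
              nlinarith [sq_nonneg (y - 9 / 20)]
            · have := out (11 / 20) w (by norm_num) (by norm_num) iw
              norm_num at this
              nlinarith [sq_nonneg (2 / 5 - y), sq_nonneg (1 / 2 - z)]
          · have := out (1 / 2) z (by norm_num) (by norm_num) iz
            norm_num at this
            nlinarith [sq_nonneg (2 / 5 - y), sq_nonneg (11 / 20 - w)]
        · have := out (2 / 5) y (by norm_num) (by norm_num) iy
          norm_num at this
          nlinarith [sq_nonneg (1 / 2 - z), sq_nonneg (11 / 20 - w)]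
      · obtain ⟨k, rfl⟩ := Nat.exists_eq_succ_of_ne_zero hmpos.ne'
        have : (1 / 8 : ℝ) ^ k ≤ 1 := pow_le_one₀ (by norm_num) (by norm_num)
        rw [Nat.succ_eq_add_one, pow_succ, pow_succ]
        linarith

lemma distortion_nonneg (μ : Measure ℝ) (α : Set ℝ) : 0 ≤ distortion μ α :=
  integral_nonneg fun _ => sq_nonneg _

lemma quarter_le_distortion_add_ncard {P : Measure ℝ} (hP : IsCondensation P nuDisc) {α : Set ℝ}
    (hf : α.Finite) (hn : α.Nonempty) :
    1 / 4 ≤ distortion P α + 1 / 4 * (α ∩ Ioo (-1 / 2) (3 / 2)).ncard := by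
  have := hP.1
  rcases (α ∩ Ioo (-1 / 2 : ℝ) (3 / 2)).eq_empty_or_nonempty with he | hne
  · have : (1 / 4 : ℝ) ≤ distortion P α := by
      have hc : ∫ _, (1 / 4 : ℝ) ∂P = 1 / 4 := by simp
      rw [← hc]
      refine integral_mono_ae (integrable_const _)
        ((continuous_infDist_sq α).integrable_of_ae_mem_Icc hP.ae_mem_Icc) ?_
      filter_upwards [hP.ae_mem_Icc] with x hx
      obtain ⟨y, hy, e⟩ := exists_infDist_sq_eq hf hn x
      have hy' : y ∉ Ioo (-1 / 2 : ℝ) (3 / 2) := fun h => by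
        have : y ∈ α ∩ Ioo (-1 / 2) (3 / 2) := ⟨hy, h⟩
        simp [he] at this
      rw [mem_Ioo, not_and_or, not_lt, not_lt] at hy'
      rw [e]
      rcases hy' with h | h <;> nlinarith [hx.1, hx.2]
    have h0 : (0 : ℝ) ≤ (α ∩ Ioo (-1 / 2) (3 / 2)).ncard := Nat.cast_nonneg _
    linarith
  · have h1 : (1 : ℝ) ≤ (α ∩ Ioo (-1 / 2) (3 / 2)).ncard := by
      exact_mod_cast (ncard_pos (hf.inter_of_left _)).2 hne
    linarith [distortion_nonneg P α]

lemma ncard_inter_windows_le {α : Set ℝ} (hf : α.Finite) :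
    (α ∩ Ioo (-1 / 10) (3 / 10)).ncard + (α ∩ Ioo (7 / 10) (11 / 10)).ncard +
      (α ∩ Ioo (3 / 10) (7 / 10)).ncard ≤ (α ∩ Ioo (-1 / 2) (3 / 2)).ncard := by
  have d1 : Disjoint (α ∩ Ioo (-1 / 10 : ℝ) (3 / 10)) (α ∩ Ioo (7 / 10) (11 / 10)) :=
    Set.disjoint_left.2 fun x hx hy => by linarith [hx.2.2, hy.2.1]
  have d2 : Disjoint (α ∩ Ioo (-1 / 10 : ℝ) (3 / 10) ∪ α ∩ Ioo (7 / 10) (11 / 10))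
      (α ∩ Ioo (3 / 10) (7 / 10)) :=
    Set.disjoint_left.2 fun x hx hy => by
      rcases hx with hx | hx <;> linarith [hx.2.1, hx.2.2, hy.2.1, hy.2.2]
  rw [← ncard_union_eq d1 (hf.inter_of_left _) (hf.inter_of_left _),
    ← ncard_union_eq d2 ((hf.inter_of_left _).union (hf.inter_of_left _)) (hf.inter_of_left _)]
  refine ncard_le_ncard (fun x hx => ?_) (hf.inter_of_left _)
  rcases hx with (hx | hx) | hx <;>
    exact ⟨hx.1, by linarith [hx.2.1], by linarith [hx.2.2]⟩

lemma distortion_condensation_ge {P : Measure ℝ} (hP : IsCondensation P nuDisc) {α : Set ℝ}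
    (hf : α.Finite) (hn : α.Nonempty) :
    1 / 75 * distortion P ((fun y => 1 / 5 * y + 0) ⁻¹' α) +
      1 / 75 * distortion P ((fun y => 1 / 5 * y + 4 / 5) ⁻¹' α) +
      1 / 3 * distortion nuDisc α ≤ distortion P α := by
  have := hP.1
  have aux : ∀ b : ℝ, 1 / 25 * distortion P ((fun y => 1 / 5 * y + b) ⁻¹' α) ≤
      ∫ x, infDist (x / 5 + b) α ^ 2 ∂P := by
    intro b
    have hT : Continuous (fun x : ℝ => x / 5 + b) := by fun_prop
    unfold distortion
    rw [← integral_const_mul]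
    refine integral_mono
      ((continuous_infDist_sq _).const_mul _ |>.integrable_of_ae_mem_Icc hP.ae_mem_Icc)
      ((continuous_infDist_sq α).comp hT |>.integrable_of_ae_mem_Icc hP.ae_mem_Icc) fun x => ?_
    have := infDist_preimage_affine_le hf hn (r := 1 / 5) (by norm_num) b x
    rw [show 1 / 5 * x + b = x / 5 + b by ring] at this
    norm_num at this ⊢
    exact this
  have a1 := aux 0
  have a2 := aux (4 / 5)
  have e := hP.integral_eq (continuous_infDist_sq α)
  simp only [add_zero] at a1 ⊢
  unfold distortion at *
  linarith

lemma distortion_condensation_le {P : Measure ℝ} (hP : IsCondensation P nuDisc) {α β γ : Set ℝ}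
    (hf : α.Finite) (hn : α.Nonempty) (h1 : (fun y => 1 / 5 * y + 0) '' α ⊆ γ)
    (h2 : (fun y => 1 / 5 * y + 4 / 5) '' α ⊆ γ) (hβ : β.Nonempty) (h3 : β ⊆ γ) :
    distortion P γ ≤ 2 / 75 * distortion P α + 1 / 3 * distortion nuDisc β := by
  have := hP.1
  have aux : ∀ b : ℝ, (fun y => 1 / 5 * y + b) '' α ⊆ γ →
      ∫ x, infDist (x / 5 + b) γ ^ 2 ∂P ≤ 1 / 25 * distortion P α := by
    intro b h
    have hT : Continuous (fun x : ℝ => x / 5 + b) := by fun_prop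
    unfold distortion
    rw [← integral_const_mul]
    refine integral_mono
      ((continuous_infDist_sq γ).comp hT |>.integrable_of_ae_mem_Icc hP.ae_mem_Icc)
      ((continuous_infDist_sq _).const_mul _ |>.integrable_of_ae_mem_Icc hP.ae_mem_Icc) fun x => ?_
    have := infDist_affine_le hf hn h x
    rw [show 1 / 5 * x + b = x / 5 + b by ring] at this
    norm_num at this ⊢
    exact this
  have a3 : distortion nuDisc γ ≤ distortion nuDisc β :=
    integral_mono ((continuous_infDist_sq γ).integrable_of_ae_mem_Icc ae_mem_Icc_nuDisc)
      ((continuous_infDist_sq β).integrable_of_ae_mem_Icc ae_mem_Icc_nuDisc) fun x =>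
      pow_le_pow_left₀ infDist_nonneg (infDist_le_infDist_of_subset h3 hβ) 2
  have a1 := aux 0 h1
  have a2 := aux (4 / 5) h2
  have e := hP.integral_eq (continuous_infDist_sq γ)
  simp only [add_zero] at a1
  unfold distortion at *
  linarith

lemma le_pow_mul_add (l m : ℕ) :
    (5 * l + 3 : ℝ) / 10 ≤ 75 ^ (l + 1) * (1 / 3 * (2 / 125 * (1 / 8) ^ m)) + 1 / 4 * m := by
  have h : (64 : ℝ) ^ l ≤ 75 ^ l := pow_le_pow_left₀ (by norm_num) (by norm_num) l
  have h8 : (0 : ℝ) < (1 / 8) ^ m := by positivity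
  have h1 : 2 / 5 * ((64 : ℝ) ^ l * (1 / 8) ^ m) ≤
      75 ^ (l + 1) * (1 / 3 * (2 / 125 * (1 / 8) ^ m)) := by
    rw [pow_succ]
    nlinarith [mul_le_mul_of_nonneg_right h h8.le]
  refine le_trans ?_ (add_le_add_left h1 _)
  have e64 : (64 : ℝ) ^ l = 8 ^ (2 * l) := by rw [pow_mul]; norm_num
  rcases le_or_gt m (2 * l) with hm | hm
  · obtain ⟨r, hr⟩ := Nat.exists_eq_add_of_le hm
    have e : (64 : ℝ) ^ l * (1 / 8) ^ m = 8 ^ r := by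
      rw [e64, hr, pow_add, mul_right_comm, ← mul_pow]; norm_num
    have hb := one_add_mul_le_pow (a := (7 : ℝ)) (by norm_num) r
    norm_num at hb
    have hr' : (2 * l : ℝ) = m + r := by exact_mod_cast hr
    have hr0 : (0 : ℝ) ≤ r := Nat.cast_nonneg _
    rw [e]
    nlinarith
  · rcases Nat.lt_or_ge (2 * l + 1) m with h' | h'
    · have : (2 * l + 2 : ℝ) ≤ m := by exact_mod_cast h'
      have : (0 : ℝ) < 64 ^ l * (1 / 8) ^ m := by positivity
      linarith
    · obtain rfl : m = 2 * l + 1 := by omega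
      have e : (64 : ℝ) ^ l * (1 / 8) ^ (2 * l + 1) = 1 / 8 := by
        rw [e64, pow_succ, ← mul_assoc, ← mul_pow]; norm_num
      rw [e]
      push_cast
      linarith

lemma distortion_condensation_lower {P : Measure ℝ} (hP : IsCondensation P nuDisc) (l : ℕ) :
    ∀ {α : Set ℝ}, α.Finite → α.Nonempty →
      21 / 20 * 2 ^ l - (5 * l + 8) / 10 ≤
        75 ^ l * distortion P α + 1 / 4 * (α ∩ Ioo (-1 / 2) (3 / 2)).ncard := by
  induction l with
  | zero =>
    intro α hf hn
    have := quarter_le_distortion_add_ncard hP hf hn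
    norm_num at this ⊢
    linarith
  | succ l ih =>
    intro α hf hn
    have h5 : (1 / 5 : ℝ) ≠ 0 := by norm_num
    have i1 := ih (preimage_affine_finite hf h5 0) (preimage_affine_nonempty hn h5 0)
    have i2 := ih (preimage_affine_finite hf h5 (4 / 5)) (preimage_affine_nonempty hn h5 (4 / 5))
    rw [ncard_preimage_affine_inter (by norm_num)] at i1 i2
    have dν := distortion_nuDisc_lower _ hf hn le_rfl
    have key := le_pow_mul_add l (α ∩ Ioo (3 / 10) (7 / 10)).ncard
    have hN : ((α ∩ Ioo (-1 / 10) (3 / 10)).ncard : ℝ) + (α ∩ Ioo (7 / 10) (11 / 10)).ncard +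
      (α ∩ Ioo (3 / 10) (7 / 10)).ncard ≤ (α ∩ Ioo (-1 / 2) (3 / 2)).ncard := by
      exact_mod_cast ncard_inter_windows_le hf
    have hD := distortion_condensation_ge hP hf hn
    have h75 : (0 : ℝ) < 75 ^ l := by positivity
    norm_num at i1 i2 hN hD
    have hD' := mul_le_mul_of_nonneg_left hD h75.le
    have dν' := mul_le_mul_of_nonneg_left dν h75.le
    rw [pow_succ] at key ⊢
    rw [pow_succ]
    push_cast
    norm_num at key ⊢
    linarith

lemma integral_eq_of_quadratic {μ : Measure ℝ} [IsProbabilityMeasure μ]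
    (h : ∀ᵐ x ∂μ, x ∈ Icc (0 : ℝ) 1) {f : ℝ → ℝ} (a b c : ℝ)
    (hf : ∀ x, f x = a * x ^ 2 + b * x + c) :
    ∫ x, f x ∂μ = a * ∫ x, x ^ 2 ∂μ + b * ∫ x, x ∂μ + c := by
  have i1 : Integrable (fun x => a * x ^ 2) μ :=
    Continuous.integrable_of_ae_mem_Icc h (by fun_prop)
  have i2 : Integrable (fun x => b * x) μ :=
    Continuous.integrable_of_ae_mem_Icc h (by fun_prop)
  have i3 : Integrable (fun x => a * x ^ 2 + b * x) μ :=
    Continuous.integrable_of_ae_mem_Icc h (by fun_prop)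
  rw [integral_congr_ae (ae_of_all _ hf), integral_add i3 (integrable_const c),
    integral_add i1 i2, integral_const_mul, integral_const_mul]
  simp

lemma integral_id_nuDisc : ∫ x, x ∂nuDisc = 7 / 15 := by
  have e := integral_nuDisc continuous_id
  simp only [id] at e
  rw [integral_eq_of_quadratic (f := fun x : ℝ => x / 2 + 3 / 10) ae_mem_Icc_nuDisc
    0 (1 / 2) (3 / 10) (fun x => by ring)] at e
  linarith

lemma integral_sq_nuDisc : ∫ x, x ^ 2 ∂nuDisc = 39 / 175 := by
  have e := integral_nuDisc (f := fun x => x ^ 2) (by fun_prop)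
  rw [integral_eq_of_quadratic (f := fun x : ℝ => (x / 2 + 3 / 10) ^ 2) ae_mem_Icc_nuDisc
    (1 / 4) (3 / 10) (9 / 100) (fun x => by ring), integral_id_nuDisc] at e
  linarith

lemma exists_distortion_nuDisc_le (m : ℕ) : ∃ β : Set ℝ, β.Finite ∧ β.Nonempty ∧
    β.ncard ≤ m + 1 ∧ distortion nuDisc β ≤ 8 / 1575 * (1 / 8) ^ m := by
  induction m with
  | zero =>
    refine ⟨{7 / 15}, finite_singleton _, singleton_nonempty _, by simp, le_of_eq ?_⟩
    simp only [distortion, infDist_singleton, Real.dist_eq, sq_abs]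
    rw [integral_eq_of_quadratic ae_mem_Icc_nuDisc 1 (-14 / 15) (49 / 225) (fun x => by ring),
      integral_id_nuDisc, integral_sq_nuDisc]
    norm_num
  | succ m ih =>
    obtain ⟨β, hf, hn, hc, hd⟩ := ih
    refine ⟨insert (2 / 5) ((fun y => 1 / 2 * y + 3 / 10) '' β), (hf.image _).insert _,
      insert_nonempty _ _, ?_, ?_⟩
    · exact (ncard_insert_le _ _).trans
        (Nat.succ_le_succ ((ncard_image_le hf).trans hc))
    · unfold distortion at hd ⊢
      rw [integral_nuDisc (continuous_infDist_sq _)]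
      have h0 := infDist_sq_le (mem_insert (2 / 5 : ℝ) ((fun y => 1 / 2 * y + 3 / 10) '' β)) (2 / 5)
      have hT : Continuous (fun x : ℝ => x / 2 + 3 / 10) := by fun_prop
      have : ∫ x, infDist (x / 2 + 3 / 10)
          (insert (2 / 5) ((fun y => 1 / 2 * y + 3 / 10) '' β)) ^ 2 ∂nuDisc ≤
          1 / 4 * ∫ x, infDist x β ^ 2 ∂nuDisc := by
        rw [← integral_const_mul]
        refine integral_mono
          ((continuous_infDist_sq _).comp hT |>.integrable_of_ae_mem_Icc ae_mem_Icc_nuDisc)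
          ((continuous_infDist_sq _).const_mul _ |>.integrable_of_ae_mem_Icc ae_mem_Icc_nuDisc)
          fun x => ?_
        have := infDist_affine_le hf hn (subset_insert (2 / 5 : ℝ)
          ((fun y => 1 / 2 * y + 3 / 10) '' β)) x
        rw [show 1 / 2 * x + 3 / 10 = x / 2 + 3 / 10 by ring] at this
        norm_num at this ⊢
        exact this
      rw [sub_self] at h0
      rw [pow_succ _ m]
      linarith

lemma IsCondensation.distortion_mean {P : Measure ℝ} (hP : IsCondensation P nuDisc) :
    distortion P {19 / 39} = 86696 / 777231 := by
  have := hP.1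
  have m1 := hP.integral_eq continuous_id
  have m2 := hP.integral_eq (f := fun x => x ^ 2) (by fun_prop)
  simp only [id] at m1
  rw [integral_eq_of_quadratic hP.ae_mem_Icc (f := fun x : ℝ => x / 5) 0 (1 / 5) 0
      (fun x => by ring), integral_eq_of_quadratic hP.ae_mem_Icc (f := fun x : ℝ => x / 5 + 4 / 5)
      0 (1 / 5) (4 / 5) (fun x => by ring), integral_id_nuDisc] at m1
  rw [integral_eq_of_quadratic hP.ae_mem_Icc (f := fun x : ℝ => (x / 5) ^ 2) (1 / 25) 0 0
      (fun x => by ring),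
    integral_eq_of_quadratic hP.ae_mem_Icc (f := fun x : ℝ => (x / 5 + 4 / 5) ^ 2)
      (1 / 25) (8 / 25) (16 / 25) (fun x => by ring), integral_sq_nuDisc] at m2
  simp only [distortion, infDist_singleton, Real.dist_eq, sq_abs]
  rw [integral_eq_of_quadratic hP.ae_mem_Icc 1 (-38 / 39) (361 / 1521) (fun x => by ring)]
  linarith

lemma exists_distortion_condensation_le {P : Measure ℝ} (hP : IsCondensation P nuDisc) (l : ℕ) :
    ∃ α : Set ℝ, α.Finite ∧ α.Nonempty ∧ α.ncard + 2 * l + 4 ≤ 5 * 2 ^ l ∧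
      distortion P α ≤
        (2 / 75) ^ l * (86696 / 777231 + 64 / 3339 * (1 - (75 / 128) ^ l)) := by
  induction l with
  | zero =>
    exact ⟨{19 / 39}, finite_singleton _, singleton_nonempty _, by simp,
      by rw [hP.distortion_mean]; norm_num⟩
  | succ l ih =>
    obtain ⟨α, hf, hn, hc, hd⟩ := ih
    obtain ⟨β, hβf, hβn, hβc, hβd⟩ := exists_distortion_nuDisc_le (2 * l + 1)
    refine ⟨(fun y => 1 / 5 * y + 0) '' α ∪ (fun y => 1 / 5 * y + 4 / 5) '' α ∪ β,
      ((hf.image _).union (hf.image _)).union hβf, hβn.inr, ?_, ?_⟩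
    · have c1 := ncard_union_le
        ((fun y : ℝ => 1 / 5 * y + 0) '' α ∪ (fun y => 1 / 5 * y + 4 / 5) '' α) β
      have c2 := ncard_union_le ((fun y : ℝ => 1 / 5 * y + 0) '' α)
        ((fun y => 1 / 5 * y + 4 / 5) '' α)
      have c3 := ncard_image_le (f := fun y : ℝ => 1 / 5 * y + 0) hf
      have c4 := ncard_image_le (f := fun y : ℝ => 1 / 5 * y + 4 / 5) hf
      rw [pow_succ]
      omega
    · have key := distortion_condensation_le hP hf hn
        (γ := (fun y => 1 / 5 * y + 0) '' α ∪ (fun y => 1 / 5 * y + 4 / 5) '' α ∪ β)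
        (subset_union_left.trans subset_union_left) (subset_union_right.trans subset_union_left)
        hβn subset_union_right
      refine key.trans ?_
      have e : ((2 / 75) ^ l * (75 / 128) ^ l : ℝ) = (1 / 8) ^ (2 * l) := by
        rw [← mul_pow, pow_mul]; norm_num
      rw [pow_succ, ← e] at hβd
      rw [pow_succ, pow_succ]
      linarith

lemma quantErr_le {μ : Measure ℝ} {n : ℕ} {α : Set ℝ} (hf : α.Finite) (hn : α.Nonempty)
    (hc : α.ncard ≤ n) : quantErr μ n ≤ distortion μ α :=
  csInf_le ⟨0, by rintro _ ⟨β, -, -, -, rfl⟩; exact distortion_nonneg μ β⟩ ⟨α, hf, hn, hc, rfl⟩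

lemma le_quantErr {μ : Measure ℝ} {n : ℕ} (h1 : 1 ≤ n) {c : ℝ}
    (h : ∀ α : Set ℝ, α.Finite → α.Nonempty → α.ncard ≤ n → c ≤ distortion μ α) :
    c ≤ quantErr μ n := by
  refine le_csInf ⟨_, {0}, finite_singleton _, singleton_nonempty _, by simpa using h1, rfl⟩ ?_
  rintro _ ⟨α, hf, hn, hc, rfl⟩
  exact h α hf hn hc

lemma quantErr_condensation_le {P : Measure ℝ} (hP : IsCondensation P nuDisc) {l n : ℕ}
    (h : 5 * 2 ^ l ≤ n) : quantErr P n ≤ (2 / 75) ^ l * (769208 / 5884749) := by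
  obtain ⟨α, hf, hn, hc, hd⟩ := exists_distortion_condensation_le hP l
  refine (quantErr_le hf hn (by omega)).trans (hd.trans ?_)
  have : (0 : ℝ) < (75 / 128) ^ l := by positivity
  gcongr
  linarith

lemma le_quantErr_condensation {P : Measure ℝ} (hP : IsCondensation P nuDisc) (l : ℕ) {n : ℕ}
    (h1 : 1 ≤ n) :
    (21 / 20 * 2 ^ l - (5 * l + 8) / 10 - 1 / 4 * n) / 75 ^ l ≤ quantErr P n := by
  refine le_quantErr h1 fun α hf hn hc => ?_
  have h := distortion_condensation_lower hP l hf hn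
  have hN : ((α ∩ Ioo (-1 / 2) (3 / 2)).ncard : ℝ) ≤ n := by
    exact_mod_cast (ncard_le_ncard inter_subset_left hf).trans hc
  rw [div_le_iff₀ (by positivity)]
  linarith

lemma mul_add_le_two_pow {l : ℕ} (hl : 13 ≤ l) : 100 * (5 * (l : ℝ) + 8) ≤ 2 ^ l := by
  induction l, hl using Nat.le_induction with
  | base => norm_num
  | succ l hl ih =>
    have : (13 : ℝ) ≤ l := by exact_mod_cast hl
    rw [pow_succ]
    push_cast
    linarith

lemma rpow_mul_linear_lower {p t : ℝ} (hp : (2 : ℝ) ^ p = 75 / 2) (h2 : 2 ≤ t) (h4 : t ≤ 4) :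
    (5 / 2 : ℝ) ^ p * (769208 / 5884749) ≤ t ^ p * (21 / 20 - t / 4 - 1 / 1000) := by
  have hp5 : 5 ≤ p := by
    rw [← Real.rpow_le_rpow_left_iff (x := 2) (by norm_num), hp]; norm_num
  have hp6 : p ≤ 6 := by
    rw [← Real.rpow_le_rpow_left_iff (x := 2) (by norm_num), hp]; norm_num
  have ht : 0 < t ^ p := by positivity
  rcases le_total t (12 / 5) with h | h
  · have hX : (5 / 2 : ℝ) ^ p ≤ 126 := by
      refine le_of_pow_le_pow_left₀ (n := 3) (by norm_num) (by norm_num) ?_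
      calc ((5 / 2 : ℝ) ^ p) ^ 3 = ((5 / 2 : ℝ) ^ 3) ^ p := (Real.rpow_pow_comm (by norm_num) _ _)
        _ ≤ ((2 : ℝ) ^ 4) ^ p := Real.rpow_le_rpow (by norm_num) (by norm_num) (by linarith)
        _ = ((2 : ℝ) ^ p) ^ 4 := (Real.rpow_pow_comm (by norm_num) _ _).symm
        _ ≤ 126 ^ 3 := by rw [hp]; norm_num
    have h2p : 75 / 2 ≤ t ^ p := by
      rw [← hp]; exact Real.rpow_le_rpow (by norm_num) h2 (by linarith)
    nlinarith
  · rcases le_total t (17 / 5) with h' | h'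
    · have e : (5 / 2 : ℝ) ^ p = (25 / 24) ^ p * (12 / 5) ^ p := by
        rw [← Real.mul_rpow (by norm_num) (by norm_num)]; norm_num
      have a : (25 / 24 : ℝ) ^ p ≤ 13 / 10 :=
        (Real.rpow_le_rpow_of_exponent_le (by norm_num) hp6).trans (by norm_num)
      have b : (12 / 5 : ℝ) ^ p ≤ t ^ p := Real.rpow_le_rpow (by norm_num) h (by linarith)
      have : (5 / 2 : ℝ) ^ p ≤ 13 / 10 * t ^ p := by rw [e]; gcongr
      nlinarith
    · have e : (5 / 2 : ℝ) ^ p = (25 / 34) ^ p * (17 / 5) ^ p := by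
        rw [← Real.mul_rpow (by norm_num) (by norm_num)]; norm_num
      have a : (25 / 34 : ℝ) ^ p ≤ 3 / 10 :=
        (Real.rpow_le_rpow_of_exponent_ge (by norm_num) (by norm_num) hp5).trans (by norm_num)
      have b : (17 / 5 : ℝ) ^ p ≤ t ^ p := Real.rpow_le_rpow (by norm_num) h' (by linarith)
      have : (5 / 2 : ℝ) ^ p ≤ 3 / 10 * t ^ p := by rw [e]; gcongr
      nlinarith

lemma rpow_mul_quantErr_le {P : Measure ℝ} (hP : IsCondensation P nuDisc) {p : ℝ}
    (hp : (2 : ℝ) ^ p = 75 / 2) (hp0 : 0 ≤ p) {n : ℕ} (hn : 5 ≤ n) :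
    (n : ℝ) ^ p * quantErr P n ≤ 10 ^ p * (769208 / 5884749) := by
  have hn5 : n / 5 ≠ 0 := by omega
  have hl := Nat.pow_log_le_self 2 hn5
  have hu := Nat.lt_pow_succ_log_self (b := 2) (by norm_num) (n / 5)
  set l := Nat.log 2 (n / 5)
  have hn' : (n : ℝ) ≤ 10 * 2 ^ l := by
    have : n ≤ 10 * 2 ^ l := by rw [Nat.pow_succ] at hu; omega
    exact_mod_cast this
  calc (n : ℝ) ^ p * quantErr P n
      ≤ (10 * 2 ^ l) ^ p * ((2 / 75) ^ l * (769208 / 5884749)) := by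
        refine mul_le_mul (Real.rpow_le_rpow (Nat.cast_nonneg _) hn' hp0)
          (quantErr_condensation_le hP (by omega)) ?_ (by positivity)
        exact le_quantErr (by omega) fun α _ _ _ => distortion_nonneg P α
    _ = 10 ^ p * (769208 / 5884749) := by
        rw [Real.mul_rpow (by norm_num) (by positivity), ← Real.rpow_pow_comm (by norm_num), hp,
          mul_assoc, ← mul_assoc ((75 / 2 : ℝ) ^ l), ← mul_pow]
        norm_num

lemma le_rpow_mul_quantErr {P : Measure ℝ} (hP : IsCondensation P nuDisc) {p : ℝ}
    (hp : (2 : ℝ) ^ p = 75 / 2) {n : ℕ} (hn : 2 ^ 14 ≤ n) :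
    (5 / 2) ^ p * (769208 / 5884749) ≤ (n : ℝ) ^ p * quantErr P n := by
  have hn2 : n / 2 ≠ 0 := by omega
  have hl := Nat.pow_log_le_self 2 hn2
  have hu := Nat.lt_pow_succ_log_self (b := 2) (by norm_num) (n / 2)
  have h13 : 13 ≤ Nat.log 2 (n / 2) := Nat.le_log_of_pow_le (by norm_num) (by omega)
  set l := Nat.log 2 (n / 2)
  have hlow : (2 * 2 ^ l : ℝ) ≤ n := by
    have : 2 * 2 ^ l ≤ n := by omega
    exact_mod_cast this
  have hup : (n : ℝ) ≤ 4 * 2 ^ l := by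
    have : n ≤ 4 * 2 ^ l := by rw [Nat.pow_succ] at hu; omega
    exact_mod_cast this
  have hl0 : (0 : ℝ) < 2 ^ l := by positivity
  obtain ⟨t, ht⟩ : ∃ t : ℝ, (n : ℝ) = 2 ^ l * t := ⟨n / 2 ^ l, by field_simp⟩
  have ht2 : 2 ≤ t := by rw [ht] at hlow; nlinarith
  have ht4 : t ≤ 4 := by rw [ht] at hup; nlinarith
  have hq := le_quantErr_condensation hP l (n := n) (by omega)
  have hε := mul_add_le_two_pow h13
  refine (rpow_mul_linear_lower hp ht2 ht4).trans ?_
  have hq' : (2 / 75) ^ l * (21 / 20 - t / 4 - 1 / 1000) ≤ quantErr P n := by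
    refine le_trans ?_ hq
    rw [div_pow, div_mul_eq_mul_div, ht]
    gcongr
    linarith
  calc t ^ p * (21 / 20 - t / 4 - 1 / 1000)
      = (n : ℝ) ^ p * ((2 / 75) ^ l * (21 / 20 - t / 4 - 1 / 1000)) := by
        rw [ht, Real.mul_rpow hl0.le (by linarith), ← Real.rpow_pow_comm (by norm_num), hp,
          mul_right_comm, ← mul_assoc ((75 / 2 : ℝ) ^ l), ← mul_pow]
        norm_num
        ring
    _ ≤ _ := by gcongr

theorem quantization_coefficients_bounds_discrete (P : MeasureTheory.Measure ℝ)
    (hP : IsCondensation P nuDisc) (κ : ℝ)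
    (hκ : κ = 2 * Real.log 2 / (Real.log 75 - Real.log 2)) :
    (25 / 4 : ℝ) ^ (1 / κ) * (769208 / 5884749) ≤
        Filter.liminf (fun n : ℕ => (n : ℝ) ^ (2 / κ) * quantErr P n) Filter.atTop ∧
    Filter.liminf (fun n : ℕ => (n : ℝ) ^ (2 / κ) * quantErr P n) Filter.atTop ≤
        Filter.limsup (fun n : ℕ => (n : ℝ) ^ (2 / κ) * quantErr P n) Filter.atTop ∧
    Filter.limsup (fun n : ℕ => (n : ℝ) ^ (2 / κ) * quantErr P n) Filter.atTop ≤
        (100 : ℝ) ^ (1 / κ) * (769208 / 5884749) := by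
  have hlog : 0 < Real.log 2 := Real.log_pos (by norm_num)
  have hlog' : 0 < Real.log 75 - Real.log 2 :=
    sub_pos.2 (Real.log_lt_log (by norm_num) (by norm_num))
  have hκ0 : 0 < κ := by rw [hκ]; positivity
  have hp : (2 : ℝ) ^ (2 / κ) = 75 / 2 := by
    rw [Real.rpow_def_of_pos (by norm_num), hκ]
    rw [show Real.log 2 * (2 / (2 * Real.log 2 / (Real.log 75 - Real.log 2))) =
      Real.log 75 - Real.log 2 by field_simp, ← Real.log_div (by norm_num) (by norm_num),
      Real.exp_log (by norm_num)]
  have sq : ∀ x : ℝ, 0 ≤ x → (x ^ 2) ^ (1 / κ) = x ^ (2 / κ) := fun x hx => by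
    rw [← Real.rpow_natCast, ← Real.rpow_mul hx]
    congr 1
    push_cast
    ring
  rw [show (25 / 4 : ℝ) = (5 / 2) ^ 2 by norm_num, show (100 : ℝ) = 10 ^ 2 by norm_num,
    sq _ (by norm_num), sq _ (by norm_num)]
  have lower : ∀ᶠ n : ℕ in atTop,
      (5 / 2) ^ (2 / κ) * (769208 / 5884749) ≤ (n : ℝ) ^ (2 / κ) * quantErr P n := by
    filter_upwards [eventually_ge_atTop (2 ^ 14)] with n hn
    exact le_rpow_mul_quantErr hP hp hn
  have upper : ∀ᶠ n : ℕ in atTop,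
      (n : ℝ) ^ (2 / κ) * quantErr P n ≤ 10 ^ (2 / κ) * (769208 / 5884749) := by
    filter_upwards [eventually_ge_atTop 5] with n hn
    exact rpow_mul_quantErr_le hP hp (by positivity) hn
  have bl := isBoundedUnder_of_eventually_ge lower
  have bu := isBoundedUnder_of_eventually_le upper
  exact ⟨le_liminf_of_le bu.isCoboundedUnder_ge lower, liminf_le_limsup bu bl,
    limsup_le_of_le bl.isCoboundedUnder_le upper⟩
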